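/- arXiv:quant-ph/0602146 — 5 statements merged into one kernel-verified Lean document; each statement's English description precedes it below -/
import Mathlib

section
/- Let H_I, H_P be Hermitian 2×2 complex matrices with H_I · H_P ≠ H_P · H_I, and let t ∈ ℝ with 0 < t < 1. Suppose e, f : Fin 2 → ℂ are orthonormal vectors (⟪e, e⟫ = ⟪f, f⟫ = 1 and ⟪e, f⟫ = 0) that are both eigenvectors of the matrix H(t) = (1−t)·H_I + t·H_P. Then ⟪e, (H_P − H_I) f⟫ ≠ 0. -/
open Finset

/-- Two-dimensional case: if the Hermitian matrices `H_I` and `H_P` do not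
commute, then for any pair of orthonormal eigenvectors of the interpolating
matrix `(1−t)·H_I + t·H_P` (with `0 < t < 1`) the matrix element of
`H_P − H_I` between them is nonzero. -/
theorem two_dim_matrix_element_ne_zero
    (HI HP : Matrix (Fin 2) (Fin 2) ℂ)
    (hHI : HI.IsHermitian) (hHP : HP.IsHermitian)
    (hcomm : HI * HP ≠ HP * HI)
    (t : ℝ) (ht0 : 0 < t) (ht1 : t < 1)
    (e f : Fin 2 → ℂ)
    (hee : ∑ i, star (e i) * e i = 1)
    (hff : ∑ i, star (f i) * f i = 1)
    (hef : ∑ i, star (e i) * f i = 0)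
    (μ ν : ℂ)
    (he : ((1 - (t : ℂ)) • HI + (t : ℂ) • HP).mulVec e = μ • e)
    (hf : ((1 - (t : ℂ)) • HI + (t : ℂ) • HP).mulVec f = ν • f) :
    ∑ i, star (e i) * ((HP - HI).mulVec f i) ≠ 0 := by
  intro h0
  set H := (1 - (t : ℂ)) • HI + (t : ℂ) • HP with hH
  set D := HP - HI with hD
  let U : Matrix (Fin 2) (Fin 2) ℂ := !![e 0, f 0; e 1, f 1]
  let N : Matrix (Fin 2) (Fin 2) ℂ := Matrix.diagonal ![μ, ν]
  have hDh : D.IsHermitian := hHP.sub hHI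
  have hfe : ∑ i, star (f i) * e i = 0 := by
    have := congrArg star hef
    simpa [mul_comm] using this
  have hU1 : U.conjTranspose * U = 1 := by
    simp only [Fin.sum_univ_two] at hee hff hef hfe
    ext i j
    fin_cases i <;> fin_cases j <;>
      simpa [U, Matrix.mul_apply, Fin.sum_univ_two, Matrix.conjTranspose_apply] using
        (by assumption)
  have hU2 : U * U.conjTranspose = 1 := mul_eq_one_comm.mp hU1
  have hHU : H * U = U * N := by
    have e0 := congrFun he 0
    have e1 := congrFun he 1
    have f0 := congrFun hf 0
    have f1 := congrFun hf 1
    clear_value H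
    simp only [Matrix.mulVec, dotProduct, Fin.sum_univ_two, Pi.smul_apply, smul_eq_mul]
      at e0 e1 f0 f1
    ext i j
    fin_cases i <;> fin_cases j <;>
      simp [U, N, Matrix.mul_apply, Fin.sum_univ_two, e0, e1, f0, f1, mul_comm] <;>
      grind
  let M := U.conjTranspose * D * U
  have hMh : M.IsHermitian := Matrix.isHermitian_conjTranspose_mul_mul U hDh
  have h01 : M 0 1 = 0 := by
    rw [← h0]
    clear_value D
    simp [M, U, Matrix.mul_apply, Fin.sum_univ_two, Matrix.mulVec, dotProduct]
    ring
  have h10 : M 1 0 = 0 := by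
    have := hMh.apply 1 0
    rw [← this, h01, star_zero]
  have hM : M = Matrix.diagonal ![M 0 0, M 1 1] := by
    ext i j
    fin_cases i <;> fin_cases j <;> simp [h01, h10]
  have hMN : M * N = N * M := by
    rw [hM]
    simp only [N, Matrix.diagonal_mul_diagonal]
    congr 1
    ext i
    ring
  have hDU : D = U * M * U.conjTranspose := by
    calc D = (U * U.conjTranspose) * D * (U * U.conjTranspose) := by rw [hU2]; simp
      _ = _ := by simp only [M, mul_assoc]
  have hHN : H = U * N * U.conjTranspose := by
    rw [← hHU, mul_assoc, hU2, mul_one]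
  have hc : H * D = D * H := by
    calc H * D = U * N * (U.conjTranspose * U) * M * U.conjTranspose := by
          rw [hHN]; nth_rewrite 1 [hDU]; simp only [mul_assoc]
      _ = U * (N * M) * U.conjTranspose := by rw [hU1]; simp only [mul_assoc, one_mul]
      _ = U * (M * N) * U.conjTranspose := by rw [hMN]
      _ = U * M * (U.conjTranspose * U) * N * U.conjTranspose := by
          rw [hU1]; simp only [mul_assoc, one_mul]
      _ = D * H := by rw [hHN]; nth_rewrite 1 [hDU]; simp only [mul_assoc]
  apply hcomm
  have hHI' : H = HI + (t : ℂ) • D := by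
    rw [hH, hD]; module
  have hc2 : HI * D = D * HI := by
    rw [hHI'] at hc
    simpa [add_mul, mul_add] using hc
  rw [hD] at hc2
  simpa [mul_sub, sub_mul] using hc2
end

section
/- Let α ∈ ℂ with α ≠ 0, let λ : ℕ → ℂ, and let f : ℕ → ℂ satisfy the coherent-state recurrence: for every k ≥ 1, α·√k·f(k−1) + conj(α)·√(k+1)·f(k+1) = λ(k)·f(k), and conj(α)·f(1) = λ(0)·f(0). If there exists N₀ ∈ ℕ such that f(n) = 0 for all n ≥ N₀, then f(n) = 0 for every n ∈ ℕ. -/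
/-- Case 1 of the paper: a solution of the coherent-state recurrence whose
components all vanish beyond some index must vanish identically. -/
theorem coherent_recurrence_eventually_zero
    (α : ℂ) (hα : α ≠ 0) (lam : ℕ → ℂ) (f : ℕ → ℂ)
    (hrec : ∀ k : ℕ, 1 ≤ k →
      α * (Real.sqrt k : ℂ) * f (k - 1) +
        (starRingEnd ℂ) α * (Real.sqrt (k + 1) : ℂ) * f (k + 1) = lam k * f k)
    (h0 : (starRingEnd ℂ) α * f 1 = lam 0 * f 0)
    (N₀ : ℕ) (hN : ∀ n : ℕ, N₀ ≤ n → f n = 0) :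
    ∀ n : ℕ, f n = 0 := by
  induction N₀ with
  | zero => exact fun n => hN n (Nat.zero_le n)
  | succ m ih =>
    apply ih
    intro n hn
    rcases Nat.eq_or_lt_of_le hn with h | h
    · subst h
      have h1 := hrec (m + 1) (Nat.le_add_left 1 m)
      rw [hN (m + 1) le_rfl, hN (m + 1 + 1) (Nat.le_succ _), Nat.add_sub_cancel,
        mul_zero, mul_zero, add_zero] at h1
      have hs : (Real.sqrt ((m + 1 : ℕ) : ℝ) : ℂ) ≠ 0 := by
        rw [Complex.ofReal_ne_zero]
        exact (Real.sqrt_pos.mpr (by positivity)).ne'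
      exact (mul_eq_zero.mp h1).resolve_left (mul_ne_zero hα hs)
    · exact hN n h
end

section
/- Let f : ℕ → ℂ and K ∈ ℕ be such that for every k ≥ K, (k+2)·‖f(k+2)‖² = (k+1)·‖f(k)‖². If there exists m ≥ K with f(m) ≠ 0, then the series Σ_n ‖f(n)‖² is not summable. -/
/-- Quantitative heart of Case 3: the two-step recursion
`(k+2)·‖f(k+2)‖² = (k+1)·‖f(k)‖²` forces `‖f(n)‖²` to decay only like `1/n`
along a parity class, so the series `Σ ‖f(n)‖²` cannot be summable unless `f`
vanishes from `K` on. -/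
theorem two_step_recursion_not_summable
    (f : ℕ → ℂ) (K : ℕ)
    (hrec : ∀ k : ℕ, K ≤ k →
      ((k : ℝ) + 2) * ‖f (k + 2)‖ ^ 2 = ((k : ℝ) + 1) * ‖f k‖ ^ 2)
    (m : ℕ) (hm : K ≤ m) (hfm : f m ≠ 0) :
    ¬ Summable (fun n : ℕ => ‖f n‖ ^ 2) := by
  intro hs
  have hpos : 0 < ‖f m‖ ^ 2 := by positivity
  have key : ∀ j : ℕ, ‖f m‖ ^ 2 ≤ ((j : ℝ) + 1) * ‖f (m + 2 * j)‖ ^ 2 := by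
    intro j
    induction j with
    | zero => simp
    | succ j ih =>
      have h := hrec (m + 2 * j) (by omega)
      have e : m + 2 * (j + 1) = m + 2 * j + 2 := by ring
      rw [e]
      refine ih.trans ?_
      push_cast at h ⊢
      have ha : 0 ≤ ‖f (m + 2 * j)‖ ^ 2 := by positivity
      generalize ‖f (m + 2 * j)‖ ^ 2 = a at *
      generalize ‖f (m + 2 * j + 2)‖ ^ 2 = b at *
      have hp : (0 : ℝ) < (m : ℝ) + 2 * j + 2 := by positivity
      have hq : 0 ≤ ((m : ℝ) + j) * a := by positivity
      refine le_of_mul_le_mul_left ?_ hp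
      linear_combination hq - ((j : ℝ) + 2) * h
  have hs2 : Summable (fun j : ℕ => ‖f (m + 2 * j)‖ ^ 2) :=
    hs.comp_injective (i := fun j : ℕ => m + 2 * j) (fun a b h => by
      simp only at h
      omega)
  have hs3 : Summable (fun j : ℕ => ‖f m‖ ^ 2 * (1 / ((j : ℝ) + 1))) := by
    refine Summable.of_nonneg_of_le (fun j => by positivity) (fun j => ?_) hs2
    have hj : (0 : ℝ) < (j : ℝ) + 1 := by positivity
    rw [mul_one_div, div_le_iff₀ hj, mul_comm]
    linarith [key j]
  have hs4 := (summable_mul_left_iff hpos.ne').1 hs3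
  refine Real.not_summable_one_div_natCast ((summable_nat_add_iff 1).1 ?_)
  simpa using hs4
end

section
/- Let α ∈ ℂ with α ≠ 0, let λ : ℕ → ℂ, and let f : ℕ → ℂ satisfy the coherent-state recurrence: for every k ≥ 1, α·√k·f(k−1) + conj(α)·√(k+1)·f(k+1) = λ(k)·f(k), and conj(α)·f(1) = λ(0)·f(0). Suppose there exist K ∈ ℕ and a parity p ∈ {0, 1} such that f(k) = 0 for every k ≥ K with k ≡ p (mod 2), and suppose the series Σ_n ‖f(n)‖² is summable. Then f(n) = 0 for every n ∈ ℕ. -/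
/-- Case 3 of the paper: a square-summable solution of the coherent-state
recurrence whose components vanish at every index of a fixed parity beyond
some point must vanish identically. -/
theorem coherent_recurrence_parity_vanishing
    (α : ℂ) (hα : α ≠ 0) (lam : ℕ → ℂ) (f : ℕ → ℂ)
    (hrec : ∀ k : ℕ, 1 ≤ k →
      α * (Real.sqrt k : ℂ) * f (k - 1) +
        (starRingEnd ℂ) α * (Real.sqrt (k + 1) : ℂ) * f (k + 1) = lam k * f k)
    (h0 : (starRingEnd ℂ) α * f 1 = lam 0 * f 0)
    (K p : ℕ) (hp : p = 0 ∨ p = 1)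
    (hvan : ∀ k : ℕ, K ≤ k → k % 2 = p → f k = 0)
    (hsum : Summable (fun n : ℕ => ‖f n‖ ^ 2)) :
    ∀ n : ℕ, f n = 0 := by
  have hcα : (starRingEnd ℂ) α ≠ 0 := by simpa using hα
  -- one step of the recurrence across a vanishing index
  have hstep : ∀ m : ℕ, K ≤ m + 1 → (m + 1) % 2 = p →
      ((m : ℝ) + 2) * ‖f (m + 2)‖ ^ 2 = ((m : ℝ) + 1) * ‖f m‖ ^ 2 := by
    intro m hm hmp
    have h := hrec (m + 1) (by omega)
    rw [hvan (m + 1) hm hmp, mul_zero, Nat.add_sub_cancel] at h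
    have h2 := congrArg (fun z : ℂ => ‖z‖ ^ 2) (eq_neg_of_add_eq_zero_left h)
    simp only [norm_neg, norm_mul, Complex.norm_real, RCLike.norm_conj, mul_pow,
      Real.norm_eq_abs, sq_abs] at h2
    rw [Real.sq_sqrt (by positivity), Real.sq_sqrt (by positivity)] at h2
    push_cast at h2
    have hpos : ‖α‖ ^ 2 ≠ 0 := by simpa using hα
    apply mul_left_cancel₀ hpos
    have e : m + 1 + 1 = m + 2 := rfl
    rw [e] at h2
    linarith
  have hodd : ∀ m : ℕ, 1 ≤ m → K ≤ m + 1 → (m + 1) % 2 = p → f m = 0 := by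
    intro m hm1 hm hmp
    by_contra hne
    have hlow : ∀ j : ℕ, (m : ℝ) * ‖f m‖ ^ 2 ≤ ((m : ℝ) + 2 * j) * ‖f (m + 2 * j)‖ ^ 2 := by
      intro j
      induction j with
      | zero => simp
      | succ j ih =>
        have h := hstep (m + 2 * j) (by omega) (by omega)
        have e : m + 2 * (j + 1) = m + 2 * j + 2 := by ring
        rw [e]
        push_cast at h ⊢
        have := sq_nonneg ‖f (m + 2 * j)‖
        linarith
    have hs : Summable (fun j : ℕ => ‖f (m + 2 * j)‖ ^ 2) :=
      hsum.comp_injective (i := fun j : ℕ => m + 2 * j) (fun a b hab => by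
        simp only at hab; omega)
    have hm0 : (1 : ℝ) ≤ m := by exact_mod_cast hm1
    have hfpos : 0 < ‖f m‖ ^ 2 := by positivity
    have hc : 0 < (m : ℝ) * ‖f m‖ ^ 2 / (m + 2) := by positivity
    have hs2 : Summable (fun j : ℕ => (m : ℝ) * ‖f m‖ ^ 2 / (m + 2) * (1 / ((j + 1 : ℕ) : ℝ))) := by
      refine Summable.of_nonneg_of_le (fun j => by positivity) (fun j => ?_) hs
      have h := hlow j
      have hj : (0 : ℝ) ≤ j := Nat.cast_nonneg j
      push_cast
      rw [div_mul_div_comm, mul_one, div_le_iff₀ (by positivity), mul_comm]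
      refine (mul_comm (‖f m‖ ^ 2) (m : ℝ)).le.trans (h.trans ?_)
      rw [mul_comm]
      refine mul_le_mul_of_nonneg_left ?_ (sq_nonneg _)
      nlinarith
    rw [summable_mul_left_iff hc.ne'] at hs2
    exact Real.not_summable_one_div_natCast
      ((summable_nat_add_iff (f := fun n : ℕ => 1 / (n : ℝ)) 1).1 hs2)
  have htail : ∀ n : ℕ, K + 1 ≤ n → f n = 0 := by
    intro n hn
    by_cases h : n % 2 = p
    · exact hvan n (by omega) h
    · exact hodd n (by omega) (by omega) (by omega)
  -- descend
  have hdesc : ∀ N : ℕ, (∀ n : ℕ, N ≤ n → f n = 0) → ∀ n : ℕ, f n = 0 := by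
    intro N
    induction N with
    | zero => exact fun h n => h n (Nat.zero_le n)
    | succ N ih =>
      intro h
      apply ih
      intro n hn
      rcases Nat.lt_or_ge N n with hlt | hge
      · exact h n hlt
      · obtain rfl : n = N := le_antisymm hge hn
        have h1 := hrec (n + 1) (by omega)
        rw [h (n + 1) le_rfl, h (n + 1 + 1) (by omega), mul_zero, mul_zero, add_zero,
          Nat.add_sub_cancel] at h1
        have hsq : (Real.sqrt ((n + 1 : ℕ) : ℝ) : ℂ) ≠ 0 := by
          rw [Complex.ofReal_ne_zero]
          exact (Real.sqrt_pos.2 (by positivity)).ne'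
        exact (mul_eq_zero.1 h1).resolve_left (mul_ne_zero hα hsq)
  exact hdesc (K + 1) htail
end

section
/- Let α ∈ ℂ with α ≠ 0, let λᵉ, λᶠ : ℕ → ℂ, and let e, f : ℕ → ℂ each satisfy the coherent-state recurrence (e with coefficient sequence λᵉ, f with coefficient sequence λᶠ): for every k ≥ 1, α·√k·e(k−1) + conj(α)·√(k+1)·e(k+1) = λᵉ(k)·e(k) and α·√k·f(k−1) + conj(α)·√(k+1)·f(k+1) = λᶠ(k)·f(k), with conj(α)·e(1) = λᵉ(0)·e(0) and conj(α)·f(1) = λᶠ(0)·f(0). Suppose both series Σ_n ‖e(n)‖² and Σ_n ‖f(n)‖² are summable, and suppose there exists M₀ ∈ ℕ such that conj(e(n))·f(n) = 0 for every n ≥ M₀. Then e(n) = 0 for every n, or f(n) = 0 for every n. -/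
/-- Two consecutive zeros force the whole solution to vanish. -/
theorem coh_aux_zero (α : ℂ) (hα : α ≠ 0) (lam e : ℕ → ℂ)
    (hrec : ∀ k : ℕ, 1 ≤ k →
      α * (Real.sqrt k : ℂ) * e (k - 1) +
        (starRingEnd ℂ) α * (Real.sqrt (k + 1) : ℂ) * e (k + 1) = lam k * e k)
    (N : ℕ) (h0 : e N = 0) (h1 : e (N + 1) = 0) : ∀ n, e n = 0 := by
  have hc : (starRingEnd ℂ) α ≠ 0 := by simpa using hα
  have hs : ∀ k : ℕ, ((Real.sqrt ((k : ℝ) + 1) : ℝ) : ℂ) ≠ 0 := by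
    intro k
    have : Real.sqrt ((k : ℝ) + 1) ≠ 0 := (Real.sqrt_pos.2 (by positivity)).ne'
    exact_mod_cast this
  have down : ∀ N : ℕ, e N = 0 → e (N + 1) = 0 → e 0 = 0 ∧ e 1 = 0 := by
    intro N
    induction N with
    | zero => intro a b; exact ⟨a, b⟩
    | succ k ih =>
      intro a b
      refine ih ?_ a
      have h := hrec (k + 1) (by omega)
      rw [a, b] at h
      push_cast at h
      simpa [hα, hs k] using h
  have up : ∀ n : ℕ, e n = 0 ∧ e (n + 1) = 0 := by
    intro n
    induction n with
    | zero => exact down N h0 h1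
    | succ k ih =>
      refine ⟨ih.2, ?_⟩
      have h := hrec (k + 1) (by omega)
      have h2 := hs (k + 1)
      rw [Nat.add_sub_cancel, ih.1, ih.2] at h
      simpa only [mul_zero, zero_add, mul_eq_zero, hc, h2, false_or] using h
  exact fun n => (up n).1

/-- A solution vanishing at every second site, but not at the next one, is not
square-summable. -/
theorem coh_aux_sum (α : ℂ) (hα : α ≠ 0) (lam e : ℕ → ℂ)
    (hrec : ∀ k : ℕ, 1 ≤ k →
      α * (Real.sqrt k : ℂ) * e (k - 1) +
        (starRingEnd ℂ) α * (Real.sqrt (k + 1) : ℂ) * e (k + 1) = lam k * e k)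
    (hsum : Summable (fun n : ℕ => ‖e n‖ ^ 2))
    (N : ℕ) (hz : ∀ j, e (N + 2 * j) = 0) : e (N + 1) = 0 := by
  by_contra hne
  have step : ∀ k : ℕ, 1 ≤ k → e k = 0 →
      ((k : ℝ) + 1) * ‖e (k + 1)‖ ^ 2 = k * ‖e (k - 1)‖ ^ 2 := by
    intro k hk hek
    have h := hrec k hk
    rw [hek, mul_zero] at h
    have h2 := congrArg norm (eq_neg_of_add_eq_zero_right h)
    rw [norm_neg] at h2
    simp only [norm_mul, RCLike.norm_conj, Complex.norm_real, Real.norm_eq_abs,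
      abs_of_nonneg (Real.sqrt_nonneg _)] at h2
    have h3 : Real.sqrt ((k : ℝ) + 1) * ‖e (k + 1)‖ = Real.sqrt k * ‖e (k - 1)‖ := by
      apply mul_left_cancel₀ (norm_ne_zero_iff.2 hα)
      linarith
    have h4 := congrArg (fun x : ℝ => x ^ 2) h3
    simp only [mul_pow] at h4
    rwa [Real.sq_sqrt (by positivity), Real.sq_sqrt (by positivity)] at h4
  set c : ℝ := ‖e (N + 1)‖ ^ 2 with hcdef
  have hc : 0 < c := by positivity
  have bd : ∀ j : ℕ, c ≤ ((N : ℝ) + 2 * j + 1) * ‖e (N + 2 * j + 1)‖ ^ 2 := by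
    intro j
    induction j with
    | zero =>
      have : (0 : ℝ) ≤ N := by positivity
      simp only [Nat.cast_zero, mul_zero, add_zero]
      nlinarith
    | succ j ih =>
      have h := step (N + 2 * (j + 1)) (by omega) (hz (j + 1))
      have e1 : N + 2 * (j + 1) - 1 = N + 2 * j + 1 := by omega
      rw [e1] at h
      push_cast at h ⊢
      rw [h]
      nlinarith [sq_nonneg ‖e (N + 2 * j + 1)‖]
  have hinj : Function.Injective (fun j : ℕ => N + 2 * j + 1) := by
    intro a b hab
    simp only at hab
    omega
  have hs1 : Summable (fun j : ℕ => ‖e (N + 2 * j + 1)‖ ^ 2) := hsum.comp_injective hinj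
  have hs2 := hs1.mul_left (((N : ℝ) + 2) / c)
  have hs3 : Summable (fun j : ℕ => 1 / ((j + 1 : ℕ) : ℝ)) := by
    refine Summable.of_nonneg_of_le (fun j => by positivity) (fun j => ?_) hs2
    have hb := bd j
    have hN : (0 : ℝ) ≤ N := by positivity
    have hj : (0 : ℝ) ≤ j := by positivity
    have hx := sq_nonneg ‖e (N + 2 * j + 1)‖
    rw [div_mul_eq_mul_div, div_le_div_iff₀ (by positivity) hc]
    push_cast
    have : ((N : ℝ) + 2 * j + 1) ≤ (N + 2) * (j + 1) := by nlinarith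
    nlinarith [mul_le_mul_of_nonneg_right this hx]
  exact Real.not_summable_one_div_natCast
    ((summable_nat_add_iff (f := fun n : ℕ => 1 / (n : ℝ)) 1).1 hs3)

/-- Cases 1–5 of the paper combined: two square-summable solutions of the
coherent-state recurrence whose componentwise products `conj(e n) · f n`
vanish eventually cannot both be nonzero. -/
theorem coherent_recurrence_eventually_disjoint_supports
    (α : ℂ) (hα : α ≠ 0) (lamE lamF : ℕ → ℂ) (e f : ℕ → ℂ)
    (hrecE : ∀ k : ℕ, 1 ≤ k →
      α * (Real.sqrt k : ℂ) * e (k - 1) +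
        (starRingEnd ℂ) α * (Real.sqrt (k + 1) : ℂ) * e (k + 1) = lamE k * e k)
    (h0E : (starRingEnd ℂ) α * e 1 = lamE 0 * e 0)
    (hrecF : ∀ k : ℕ, 1 ≤ k →
      α * (Real.sqrt k : ℂ) * f (k - 1) +
        (starRingEnd ℂ) α * (Real.sqrt (k + 1) : ℂ) * f (k + 1) = lamF k * f k)
    (h0F : (starRingEnd ℂ) α * f 1 = lamF 0 * f 0)
    (hsumE : Summable (fun n : ℕ => ‖e n‖ ^ 2))
    (hsumF : Summable (fun n : ℕ => ‖f n‖ ^ 2))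
    (M₀ : ℕ) (hM : ∀ n : ℕ, M₀ ≤ n → (starRingEnd ℂ) (e n) * f n = 0) :
    (∀ n : ℕ, e n = 0) ∨ (∀ n : ℕ, f n = 0) := by
  by_contra hcon
  rw [not_or] at hcon
  obtain ⟨hE, hF⟩ := hcon
  have hM' : ∀ n, M₀ ≤ n → e n = 0 ∨ f n = 0 := by
    intro n hn
    simpa using hM n hn
  have zE : ∀ n, e n = 0 → e (n + 1) ≠ 0 := fun n a b =>
    hE (coh_aux_zero α hα lamE e hrecE n a b)
  have zF : ∀ n, f n = 0 → f (n + 1) ≠ 0 := fun n a b =>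
    hF (coh_aux_zero α hα lamF f hrecF n a b)
  have sE : ∀ n, M₀ ≤ n → e n = 0 → f (n + 1) = 0 := fun n hn a =>
    (hM' (n + 1) (by omega)).resolve_left (zE n a)
  have sF : ∀ n, M₀ ≤ n → f n = 0 → e (n + 1) = 0 := fun n hn a =>
    (hM' (n + 1) (by omega)).resolve_right (zF n a)
  obtain ⟨N, hN, hN0⟩ : ∃ N, M₀ ≤ N ∧ e N = 0 := by
    rcases hM' M₀ le_rfl with h | h
    · exact ⟨M₀, le_rfl, h⟩
    · exact ⟨M₀ + 1, by omega, sF _ le_rfl h⟩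
  have hz : ∀ j, e (N + 2 * j) = 0 := by
    intro j
    induction j with
    | zero => exact hN0
    | succ j ih => exact sF (N + 2 * j + 1) (by omega) (sE _ (by omega) ih)
  exact zE N hN0 (coh_aux_sum α hα lamE e hrecE hsumE N hz)
end
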